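/- arXiv:2507.14487 — 3 statements merged into one kernel-verified Lean document; each statement's English description precedes it below -/
import Mathlib

section
/- Let S and A be finite nonempty sets, let P_1,…,P_K be transition kernels on (S,A) whose neighboring sets coincide (N_{P_1}^s = ⋯ = N_{P_K}^s for every s ∈ S), let r : S × A → ℝ be a reward, γ ∈ (0,1), ω ∈ [0,1), and let Q* be a fixed point of the averaged operator (1/K)Σ_{k=1}^K T_{P_k,ω}. Let Q^1_t,…,Q^K_t : S × A → ℝ be arbitrary, let λ_t ∈ [0,1], set Q̄_t = (1/K)Σ_k Q^k_t and Q̄_{t+1} = (1/K)Σ_k [ (1−λ_t) Q^k_t + λ_t T_{P_k,ω} Q^k_t ]. Then ‖Q̄_{t+1} − Q*‖_∞ ≤ (1 − (1−γ)λ_t) ‖Q̄_t − Q*‖_∞ + (γ λ_t / K) Σ_{k=1}^K ‖Q^k_t − Q̄_t‖_∞. -/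
open Finset

/-- `P` is a transition kernel on `(S, A)`: nonnegative entries and each
`P (s) (a) (·)` sums to one. -/
def IsKernel {S A : Type*} [Fintype S] (P : S → A → S → ℝ) : Prop :=
  (∀ s a s', 0 ≤ P s a s') ∧ (∀ s a, ∑ s', P s a s' = 1)

/-- `max_{a'} Q(s, a')` over the finite nonempty action set. -/
noncomputable def maxA {S A : Type*} [Fintype A] [Nonempty A] (Q : S → A → ℝ) (s : S) : ℝ :=
  Finset.univ.sup' Finset.univ_nonempty (Q s)

open scoped Classical in
/-- The neighboring set `N_P^s = { s' : ∑_a P(s'|s,a) ≠ 0 }`. -/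
noncomputable def nbr {S A : Type*} [Fintype S] [Fintype A] (P : S → A → S → ℝ) (s : S) :
    Finset S :=
  Finset.univ.filter (fun s' => ∑ a, P s a s' ≠ 0)

/-- The robust Bellman operator `T_{P,ω}`. The minimum over the (nonempty, finite)
neighboring set is expressed via `sInf` of the image. -/
noncomputable def bellman {S A : Type*} [Fintype S] [Fintype A] [Nonempty A]
    (P : S → A → S → ℝ) (r : S → A → ℝ) (γ ω : ℝ) (Q : S → A → ℝ) : S → A → ℝ :=
  fun s a => r s a + γ * ((1 - ω) * ∑ s', P s a s' * maxA Q s'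
    + ω * sInf ((fun s' => maxA Q s') '' (nbr P s : Set S)))

/-- The sup norm `‖Q‖_∞ = max_{(s,a)} |Q(s,a)|`. -/
noncomputable def supNorm {S A : Type*} [Fintype S] [Fintype A] [Nonempty S] [Nonempty A]
    (Q : S → A → ℝ) : ℝ :=
  Finset.univ.sup' Finset.univ_nonempty (fun p : S × A => |Q p.1 p.2|)

theorem abs_sup'_sub_sup'_le {ι : Type*} {s : Finset ι} (hs : s.Nonempty) {f g : ι → ℝ} {c : ℝ}
    (h : ∀ i ∈ s, |f i - g i| ≤ c) : |s.sup' hs f - s.sup' hs g| ≤ c := by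
  have key : ∀ u v : ι → ℝ, (∀ i ∈ s, u i ≤ v i + c) → s.sup' hs u ≤ s.sup' hs v + c :=
    fun u v huv => Finset.sup'_le hs u fun i hi =>
      (huv i hi).trans (by gcongr; exact Finset.le_sup' v hi)
  have h₁ := key f g fun i hi => by linarith [(abs_le.1 (h i hi)).2]
  have h₂ := key g f fun i hi => by linarith [(abs_le.1 (h i hi)).1]
  exact abs_le.2 ⟨by linarith, by linarith⟩

theorem abs_sInf_image_sub_sInf_image_le {ι : Type*} (s : Finset ι) {f g : ι → ℝ} {c : ℝ}
    (hc : 0 ≤ c) (h : ∀ i ∈ s, |f i - g i| ≤ c) :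
    |sInf (f '' (s : Set ι)) - sInf (g '' (s : Set ι))| ≤ c := by
  rcases s.eq_empty_or_nonempty with rfl | hs
  · simpa using hc
  have key : ∀ u v : ι → ℝ, (∀ i ∈ s, u i ≤ v i + c) →
      sInf (u '' (s : Set ι)) - c ≤ sInf (v '' (s : Set ι)) := by
    intro u v huv
    refine le_csInf (Set.Nonempty.image v hs) ?_
    rintro _ ⟨i, hi, rfl⟩
    have := csInf_le (s.finite_toSet.image u).bddBelow (Set.mem_image_of_mem u hi)
    linarith [huv i hi]
  have h₁ := key f g fun i hi => by linarith [(abs_le.1 (h i hi)).2]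
  have h₂ := key g f fun i hi => by linarith [(abs_le.1 (h i hi)).1]
  exact abs_le.2 ⟨by linarith, by linarith⟩

section SupNorm

variable {S A : Type*} [Fintype S] [Fintype A] [Nonempty S] [Nonempty A]

theorem abs_le_supNorm (Q : S → A → ℝ) (s : S) (a : A) : |Q s a| ≤ supNorm Q :=
  Finset.le_sup' (fun p : S × A => |Q p.1 p.2|) (Finset.mem_univ (s, a))

theorem supNorm_le {Q : S → A → ℝ} {c : ℝ} (h : ∀ s a, |Q s a| ≤ c) : supNorm Q ≤ c :=
  Finset.sup'_le _ _ fun p _ => h p.1 p.2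

theorem supNorm_nonneg (Q : S → A → ℝ) : 0 ≤ supNorm Q :=
  (abs_nonneg _).trans (abs_le_supNorm Q (Classical.arbitrary S) (Classical.arbitrary A))

theorem supNorm_sub_le (Q₁ Q₂ Q₃ : S → A → ℝ) :
    supNorm (Q₁ - Q₃) ≤ supNorm (Q₁ - Q₂) + supNorm (Q₂ - Q₃) :=
  supNorm_le fun s a => (abs_sub_le (Q₁ s a) (Q₂ s a) (Q₃ s a)).trans <|
    add_le_add (abs_le_supNorm (Q₁ - Q₂) s a) (abs_le_supNorm (Q₂ - Q₃) s a)

theorem abs_maxA_sub_maxA_le (Q Q' : S → A → ℝ) (s : S) :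
    |maxA Q s - maxA Q' s| ≤ supNorm (Q - Q') :=
  abs_sup'_sub_sup'_le _ fun a _ => abs_le_supNorm (Q - Q') s a

/-- The robust Bellman operator is a `γ`-contraction in the sup norm. -/
theorem abs_bellman_sub_bellman_le {P : S → A → S → ℝ} (hP : IsKernel P) (r : S → A → ℝ)
    {γ ω : ℝ} (hγ : 0 ≤ γ) (hω0 : 0 ≤ ω) (hω1 : ω ≤ 1) (Q Q' : S → A → ℝ) (s : S) (a : A) :
    |bellman P r γ ω Q s a - bellman P r γ ω Q' s a| ≤ γ * supNorm (Q - Q') := by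
  have h_sum : |∑ s', P s a s' * (maxA Q s' - maxA Q' s')| ≤ supNorm (Q - Q') :=
    calc |∑ s', P s a s' * (maxA Q s' - maxA Q' s')|
        ≤ ∑ s', |P s a s' * (maxA Q s' - maxA Q' s')| := Finset.abs_sum_le_sum_abs _ _
      _ ≤ ∑ s', P s a s' * supNorm (Q - Q') := Finset.sum_le_sum fun s' _ => by
          rw [abs_mul, abs_of_nonneg (hP.1 s a s')]
          exact mul_le_mul_of_nonneg_left (abs_maxA_sub_maxA_le Q Q' s') (hP.1 s a s')
      _ = supNorm (Q - Q') := by rw [← Finset.sum_mul, hP.2 s a, one_mul]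
  have h_inf := abs_sInf_image_sub_sInf_image_le (nbr P s) (supNorm_nonneg (Q - Q'))
    fun s' _ => abs_maxA_sub_maxA_le Q Q' s'
  have h_eq : bellman P r γ ω Q s a - bellman P r γ ω Q' s a =
      γ * ((1 - ω) * ∑ s', P s a s' * (maxA Q s' - maxA Q' s') +
        ω * (sInf (maxA Q '' (nbr P s : Set S)) - sInf (maxA Q' '' (nbr P s : Set S)))) := by
    simp only [bellman, mul_sub, Finset.sum_sub_distrib]
    ring
  rw [h_eq, abs_mul, abs_of_nonneg hγ]
  refine mul_le_mul_of_nonneg_left ((abs_add_le _ _).trans ?_) hγ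
  rw [abs_mul, abs_mul, abs_of_nonneg hω0, abs_of_nonneg (sub_nonneg.2 hω1)]
  nlinarith [mul_le_mul_of_nonneg_left h_sum (sub_nonneg.2 hω1),
    mul_le_mul_of_nonneg_left h_inf hω0]

end SupNorm

/-- Lemma 1: one-step recursion for the averaged FedRQ iterate:
‖Q̄_{t+1} − Q*‖_∞ ≤ (1 − (1−γ)λ_t)‖Q̄_t − Q*‖_∞ + (γλ_t/K) Σ_k ‖Q^k_t − Q̄_t‖_∞. -/
theorem fedRQ_one_step_bound
    {S A : Type*} [Fintype S] [Fintype A] [Nonempty S] [Nonempty A]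
    (K : ℕ) (hK : 0 < K) (P : Fin K → S → A → S → ℝ) (hP : ∀ k, IsKernel (P k))
    (hnbr : ∀ s : S, ∀ k k' : Fin K, nbr (P k) s = nbr (P k') s)
    (r : S → A → ℝ) (γ ω : ℝ) (hγ0 : 0 < γ) (hγ1 : γ < 1) (hω0 : 0 ≤ ω) (hω1 : ω < 1)
    (Qstar : S → A → ℝ)
    (hQstar : (fun s a => (1 / (K : ℝ)) * ∑ k, bellman (P k) r γ ω Qstar s a) = Qstar)
    (Qk : Fin K → S → A → ℝ) (lam : ℝ) (hlam0 : 0 ≤ lam) (hlam1 : lam ≤ 1)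
    (Qbar Qbar' : S → A → ℝ)
    (hQbar : Qbar = fun s a => (1 / (K : ℝ)) * ∑ k, Qk k s a)
    (hQbar' : Qbar' = fun s a => (1 / (K : ℝ)) *
      ∑ k, ((1 - lam) * Qk k s a + lam * bellman (P k) r γ ω (Qk k) s a)) :
    supNorm (Qbar' - Qstar) ≤ (1 - (1 - γ) * lam) * supNorm (Qbar - Qstar)
      + (γ * lam / (K : ℝ)) * ∑ k, supNorm (Qk k - Qbar) := by
  have hK' : (0 : ℝ) < K := Nat.cast_pos.2 hK
  refine supNorm_le fun s a => ?_
  have h_eq : (Qbar' - Qstar) s a = (1 - lam) * (Qbar - Qstar) s a +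
      lam / K * ∑ k, (bellman (P k) r γ ω (Qk k) s a - bellman (P k) r γ ω Qstar s a) := by
    have h_fix := congrFun (congrFun hQstar s) a
    simp only [hQbar, hQbar', Pi.sub_apply, Finset.sum_add_distrib, ← Finset.mul_sum,
      Finset.sum_sub_distrib]
    linear_combination lam * h_fix
  have h_sum : |∑ k, (bellman (P k) r γ ω (Qk k) s a - bellman (P k) r γ ω Qstar s a)| ≤
      γ * (∑ k, supNorm (Qk k - Qbar) + K * supNorm (Qbar - Qstar)) :=
    calc _ ≤ ∑ k, |bellman (P k) r γ ω (Qk k) s a - bellman (P k) r γ ω Qstar s a| :=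
          Finset.abs_sum_le_sum_abs _ _
      _ ≤ ∑ k, γ * (supNorm (Qk k - Qbar) + supNorm (Qbar - Qstar)) :=
          Finset.sum_le_sum fun k _ =>
            (abs_bellman_sub_bellman_le (hP k) r hγ0.le hω0 hω1.le (Qk k) Qstar s a).trans <|
              mul_le_mul_of_nonneg_left (supNorm_sub_le _ _ _) hγ0.le
      _ = _ := by
          simp [← Finset.mul_sum, Finset.sum_add_distrib]
  have h_nonneg : 0 ≤ lam / K := div_nonneg hlam0 hK'.le
  calc |(Qbar' - Qstar) s a|
      ≤ (1 - lam) * |(Qbar - Qstar) s a| + lam / K *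
          |∑ k, (bellman (P k) r γ ω (Qk k) s a - bellman (P k) r γ ω Qstar s a)| := by
        rw [h_eq]
        refine (abs_add_le _ _).trans_eq ?_
        rw [abs_mul, abs_mul, abs_of_nonneg (sub_nonneg.2 hlam1), abs_of_nonneg h_nonneg]
    _ ≤ (1 - lam) * supNorm (Qbar - Qstar) + lam / K *
          (γ * (∑ k, supNorm (Qk k - Qbar) + K * supNorm (Qbar - Qstar))) :=
        add_le_add
          (mul_le_mul_of_nonneg_left (abs_le_supNorm _ s a) (sub_nonneg.2 hlam1))
          (mul_le_mul_of_nonneg_left h_sum h_nonneg)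
    _ = _ := by
        field_simp
        ring
end

section
/- Let S and A be finite nonempty sets, P_1,…,P_K transition kernels on (S,A), r : S × A → [0,1] a reward, γ ∈ (0,1), ω ∈ [0,1), E ≥ 1 an integer, and λ_t = 2/((1−γ)(t+E)). Suppose the local iterates satisfy Q^k_{t'+1} = (1−λ_{t'}) Q^k_{t'} + λ_{t'} T_{P_k,ω} Q^k_{t'} for t' = t_0, …, t−1 for some t_0 with t − E + 1 ≤ t_0 ≤ t at which all agents are synchronized (Q^k_{t_0} = Q̄_{t_0} for all k), and that every iterate satisfies 0 ≤ Q^k_{t'}(s,a) ≤ 1/(1−γ) for all (s,a). Then, with Q̄_t = (1/K)Σ_k Q^k_t, (1/K) Σ_{k=1}^K ‖Q^k_t − Q̄_t‖_∞ ≤ 4 λ_t (E−1) / (1−γ). -/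
open Finset

theorem maxA_mem_Icc {S A : Type*} [Fintype A] [Nonempty A] {Q : S → A → ℝ} {M : ℝ}
    (hQ : ∀ s a, 0 ≤ Q s a ∧ Q s a ≤ M) (s : S) : 0 ≤ maxA Q s ∧ maxA Q s ≤ M := by
  refine ⟨?_, Finset.sup'_le _ _ fun a _ => (hQ s a).2⟩
  obtain ⟨a⟩ := ‹Nonempty A›
  exact (hQ s a).1.trans (Finset.le_sup' (Q s) (Finset.mem_univ a))

theorem sInf_image_mem_Icc {S : Type*} {f : S → ℝ} {M : ℝ} (hM : 0 ≤ M)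
    (hf : ∀ s, 0 ≤ f s ∧ f s ≤ M) (N : Set S) : 0 ≤ sInf (f '' N) ∧ sInf (f '' N) ≤ M := by
  have hnonneg : ∀ x ∈ f '' N, 0 ≤ x := by
    rintro _ ⟨s, _, rfl⟩
    exact (hf s).1
  refine ⟨Real.sInf_nonneg hnonneg, ?_⟩
  rcases N.eq_empty_or_nonempty with rfl | ⟨s, hs⟩
  · simpa using hM
  · exact (csInf_le ⟨0, hnonneg⟩ ⟨s, hs, rfl⟩).trans (hf s).2

theorem bellman_mem_Icc {S A : Type*} [Fintype S] [Fintype A] [Nonempty A]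
    {P : S → A → S → ℝ} (hP : IsKernel P) {r : S → A → ℝ} (hr : ∀ s a, 0 ≤ r s a ∧ r s a ≤ 1)
    {γ ω : ℝ} (hγ0 : 0 < γ) (hγ1 : γ < 1) (hω0 : 0 ≤ ω) (hω1 : ω < 1) {Q : S → A → ℝ}
    (hQ : ∀ s a, 0 ≤ Q s a ∧ Q s a ≤ 1 / (1 - γ)) (s : S) (a : A) :
    0 ≤ bellman P r γ ω Q s a ∧ bellman P r γ ω Q s a ≤ 1 / (1 - γ) := by
  have hγ : 0 < 1 - γ := sub_pos.2 hγ1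
  have hω : 0 ≤ 1 - ω := sub_nonneg.2 hω1.le
  have hfix : 1 + γ * (1 / (1 - γ)) = 1 / (1 - γ) := by field_simp; ring
  have hM : 0 ≤ 1 / (1 - γ) := by positivity
  generalize 1 / (1 - γ) = M at *
  have hmax := maxA_mem_Icc hQ
  obtain ⟨hi0, hi1⟩ := sInf_image_mem_Icc hM hmax (nbr P s : Set S)
  have hs0 : 0 ≤ ∑ s', P s a s' * maxA Q s' :=
    Finset.sum_nonneg fun s' _ => mul_nonneg (hP.1 s a s') (hmax s').1
  have hs1 : ∑ s', P s a s' * maxA Q s' ≤ M :=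
    calc ∑ s', P s a s' * maxA Q s' ≤ ∑ s', P s a s' * M :=
          Finset.sum_le_sum fun s' _ => mul_le_mul_of_nonneg_left (hmax s').2 (hP.1 s a s')
      _ = M := by rw [← Finset.sum_mul, hP.2, one_mul]
  unfold bellman
  constructor
  · have := (hr s a).1
    positivity
  · have hmix := add_le_add (mul_le_mul_of_nonneg_left hs1 hω) (mul_le_mul_of_nonneg_left hi1 hω0)
    have := mul_le_mul_of_nonneg_left (hmix.trans_eq (by ring : _ = M)) hγ0.le
    linarith [(hr s a).2]

theorem abs_average_le {K : ℕ} (hK : 0 < K) {x : Fin K → ℝ} {B : ℝ} (hx : ∀ k, |x k| ≤ B) :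
    |(1 / (K : ℝ)) * ∑ k, x k| ≤ B := by
  have hK' : (0 : ℝ) < K := Nat.cast_pos.2 hK
  rw [abs_mul, abs_of_pos (by positivity), one_div_mul_eq_div, div_le_iff₀ hK']
  calc |∑ k, x k| ≤ ∑ k, |x k| := Finset.abs_sum_le_sum_abs _ _
    _ ≤ ∑ _k : Fin K, B := Finset.sum_le_sum fun k _ => hx k
    _ = B * K := by simp [mul_comm]

/-- Lemma 2: drift bound between local iterates and their average:
(1/K) Σ_k ‖Q^k_t − Q̄_t‖_∞ ≤ 4 λ_t (E−1)/(1−γ). -/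
theorem fedRQ_drift_bound
    {S A : Type*} [Fintype S] [Fintype A] [Nonempty S] [Nonempty A]
    (K : ℕ) (hK : 0 < K) (P : Fin K → S → A → S → ℝ) (hP : ∀ k, IsKernel (P k))
    (r : S → A → ℝ) (hr : ∀ s a, 0 ≤ r s a ∧ r s a ≤ 1)
    (γ ω : ℝ) (hγ0 : 0 < γ) (hγ1 : γ < 1) (hω0 : 0 ≤ ω) (hω1 : ω < 1)
    (E : ℕ) (hE : 1 ≤ E)
    (lam : ℕ → ℝ) (hlam : ∀ n : ℕ, lam n = 2 / ((1 - γ) * ((n : ℝ) + (E : ℝ))))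
    (Q : ℕ → Fin K → S → A → ℝ)
    (Qbar : ℕ → S → A → ℝ)
    (hQbar : ∀ n, Qbar n = fun s a => (1 / (K : ℝ)) * ∑ k, Q n k s a)
    (t t₀ : ℕ) (ht₀ : t₀ ≤ t) (ht₀' : t < t₀ + E)
    (hsync : ∀ k, Q t₀ k = Qbar t₀)
    (hstep : ∀ t', t₀ ≤ t' → t' < t → ∀ k, Q (t' + 1) k
      = fun s a => (1 - lam t') * Q t' k s a + lam t' * bellman (P k) r γ ω (Q t' k) s a)
    (hbdd : ∀ t', t₀ ≤ t' → t' ≤ t → ∀ k s a, 0 ≤ Q t' k s a ∧ Q t' k s a ≤ 1 / (1 - γ)) :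
    (1 / (K : ℝ)) * ∑ k, supNorm (Q t k - Qbar t)
      ≤ 4 * lam t * ((E : ℝ) - 1) / (1 - γ) := by
  have hγ : 0 < 1 - γ := sub_pos.2 hγ1
  have hM : 0 ≤ 1 / (1 - γ) := by positivity
  have hE' : (1 : ℝ) ≤ E := Nat.one_le_cast.2 hE
  have hlam0 : ∀ n, 0 ≤ lam n := fun n => by rw [hlam]; positivity
  have hanti : ∀ n, t₀ ≤ n → lam n ≤ lam t₀ := fun n hn => by
    rw [hlam, hlam]
    have : (t₀ : ℝ) ≤ n := Nat.cast_le.2 hn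
    gcongr
  have hdouble : lam t₀ ≤ 2 * lam t := by
    rw [hlam, hlam, ← mul_div_assoc, div_le_div_iff₀ (by positivity) (by positivity)]
    have : (t : ℝ) ≤ t₀ + E := by exact_mod_cast ht₀'.le
    have := mul_le_mul_of_nonneg_left this hγ.le
    have : 0 ≤ (1 - γ) * (t₀ : ℝ) := by positivity
    linarith
  have hlocal : ∀ n : ℕ, t₀ + n ≤ t → ∀ k s a,
      |Q (t₀ + n) k s a - Q t₀ k s a| ≤ n * (lam t₀ * (1 / (1 - γ))) := by
    intro n
    induction n with
    | zero => intro _ k s a; simp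
    | succ n ih =>
      intro hn k s a
      have hQ := hbdd (t₀ + n) (by omega) (by omega) k
      have hT := bellman_mem_Icc (hP k) hr hγ0 hγ1 hω0 hω1 hQ s a
      have hgap : |bellman (P k) r γ ω (Q (t₀ + n) k) s a - Q (t₀ + n) k s a| ≤ 1 / (1 - γ) :=
        abs_le.2 ⟨by linarith [(hQ s a).2], by linarith [(hQ s a).1]⟩
      have hinc : |lam (t₀ + n) * (bellman (P k) r γ ω (Q (t₀ + n) k) s a - Q (t₀ + n) k s a)|
          ≤ lam t₀ * (1 / (1 - γ)) := by
        rw [abs_mul, abs_of_nonneg (hlam0 _)]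
        exact mul_le_mul (hanti _ (by omega)) hgap (abs_nonneg _) (hlam0 _)
      have hsplit : Q (t₀ + (n + 1)) k s a - Q t₀ k s a = (Q (t₀ + n) k s a - Q t₀ k s a)
          + lam (t₀ + n) * (bellman (P k) r γ ω (Q (t₀ + n) k) s a - Q (t₀ + n) k s a) := by
        rw [← add_assoc, hstep (t₀ + n) (by omega) (by omega) k]
        ring
      rw [hsplit]
      refine (abs_add_le _ _).trans ((add_le_add (ih (by omega) k s a) hinc).trans_eq ?_)
      push_cast
      ring
  have hdrift : ∀ k s a,
      |Q t k s a - Qbar t₀ s a| ≤ 2 * lam t * ((E : ℝ) - 1) * (1 / (1 - γ)) := by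
    intro k s a
    have h := hlocal (t - t₀) (by omega) k s a
    rw [Nat.add_sub_cancel' ht₀, hsync k] at h
    have hn : ((t - t₀ : ℕ) : ℝ) ≤ (E : ℝ) - 1 := by
      rw [le_sub_iff_add_le]
      exact_mod_cast (by omega : t - t₀ + 1 ≤ E)
    calc |Q t k s a - Qbar t₀ s a| ≤ ((t - t₀ : ℕ) : ℝ) * (lam t₀ * (1 / (1 - γ))) := h
      _ ≤ ((E : ℝ) - 1) * (2 * lam t * (1 / (1 - γ))) := by
        have := hlam0 t₀
        gcongr
      _ = _ := by ring
  have hmean : ∀ s a,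
      |Qbar t s a - Qbar t₀ s a| ≤ 2 * lam t * ((E : ℝ) - 1) * (1 / (1 - γ)) := by
    intro s a
    have hK' : (K : ℝ) ≠ 0 := Nat.cast_ne_zero.2 hK.ne'
    have h : Qbar t s a - Qbar t₀ s a
        = (1 / (K : ℝ)) * ∑ k, (Q t k s a - Qbar t₀ s a) := by
      rw [hQbar t, Finset.sum_sub_distrib, mul_sub]
      simp [hK']
    rw [h]
    exact abs_average_le hK fun k => hdrift k s a
  have hnorm : ∀ k, supNorm (Q t k - Qbar t) ≤ 4 * lam t * ((E : ℝ) - 1) / (1 - γ) := by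
    refine fun k => Finset.sup'_le _ _ fun p _ => ?_
    calc |(Q t k - Qbar t) p.1 p.2|
        = |(Q t k p.1 p.2 - Qbar t₀ p.1 p.2) - (Qbar t p.1 p.2 - Qbar t₀ p.1 p.2)| := by
          simp
      _ ≤ _ := (abs_sub _ _).trans (add_le_add (hdrift k _ _) (hmean _ _))
      _ = _ := by ring
  have hK' : (0 : ℝ) < K := Nat.cast_pos.2 hK
  rw [one_div_mul_eq_div, div_le_iff₀ hK']
  calc ∑ k, supNorm (Q t k - Qbar t)
      ≤ ∑ _k : Fin K, 4 * lam t * ((E : ℝ) - 1) / (1 - γ) :=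
        Finset.sum_le_sum fun k _ => hnorm k
    _ = 4 * lam t * ((E : ℝ) - 1) / (1 - γ) * K := by simp [mul_comm]
end

section
/- Let S and A be finite nonempty sets, P a transition kernel on (S,A), r : S × A → ℝ a reward, γ ∈ (0,1), and ω ∈ [0,1]. Then the robust Bellman operator T_{P,ω} has a unique fixed point: there exists a unique Q* : S × A → ℝ with T_{P,ω} Q* = Q*. -/
open Finset

lemma maxA_le_add {S A : Type*} [Fintype A] [Nonempty A] {Q Q' : S → A → ℝ} {c : ℝ}
    (h : ∀ s a, Q s a ≤ Q' s a + c) (s : S) : maxA Q s ≤ maxA Q' s + c := by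
  refine Finset.sup'_le _ _ fun a ha => (h s a).trans ?_
  gcongr
  exact Finset.le_sup' (Q' s) ha

/-- The nonnegativity of `c` is needed only for an empty `t`, where both infima are `0`. -/
lemma sInf_image_le_add {S : Type*} {f g : S → ℝ} {c : ℝ} (hc : 0 ≤ c)
    (h : ∀ s, f s ≤ g s + c) (t : Finset S) :
    sInf (f '' (t : Set S)) ≤ sInf (g '' (t : Set S)) + c := by
  rcases t.eq_empty_or_nonempty with rfl | ht
  · simpa using hc
  rw [← sub_le_iff_le_add]
  refine le_csInf ((Finset.coe_nonempty.2 ht).image g) ?_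
  rintro _ ⟨s, hs, rfl⟩
  have hle := csInf_le (t.finite_toSet.image f).bddBelow (Set.mem_image_of_mem f hs)
  linarith [h s]

lemma bellman_le_add {S A : Type*} [Fintype S] [Fintype A] [Nonempty A]
    {P : S → A → S → ℝ} (hP : IsKernel P) (r : S → A → ℝ) {γ ω : ℝ} (hγ : 0 ≤ γ)
    (hω0 : 0 ≤ ω) (hω1 : ω ≤ 1) {Q Q' : S → A → ℝ} {c : ℝ} (hc : 0 ≤ c)
    (h : ∀ s a, Q s a ≤ Q' s a + c) (s : S) (a : A) :
    bellman P r γ ω Q s a ≤ bellman P r γ ω Q' s a + γ * c := by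
  have hsum : ∑ s', P s a s' * maxA Q s' ≤ ∑ s', P s a s' * maxA Q' s' + c := by
    calc ∑ s', P s a s' * maxA Q s'
        ≤ ∑ s', P s a s' * (maxA Q' s' + c) := Finset.sum_le_sum fun s' _ =>
          mul_le_mul_of_nonneg_left (maxA_le_add h s') (hP.1 s a s')
      _ = ∑ s', P s a s' * maxA Q' s' + c := by
          simp only [mul_add, Finset.sum_add_distrib]
          rw [← Finset.sum_mul Finset.univ (P s a) c, hP.2, one_mul]
  have hinf := sInf_image_le_add hc (maxA_le_add h) (nbr P s)
  have hmix := mul_le_mul_of_nonneg_left (add_le_add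
    (mul_le_mul_of_nonneg_left hsum (sub_nonneg.2 hω1)) (mul_le_mul_of_nonneg_left hinf hω0)) hγ
  unfold bellman
  linarith

lemma contractingWith_bellman {S A : Type*} [Fintype S] [Fintype A] [Nonempty A]
    {P : S → A → S → ℝ} (hP : IsKernel P) (r : S → A → ℝ) {γ ω : ℝ} (hγ0 : 0 ≤ γ)
    (hγ1 : γ < 1) (hω0 : 0 ≤ ω) (hω1 : ω ≤ 1) :
    ContractingWith ⟨γ, hγ0⟩ (bellman P r γ ω) := by
  refine ⟨hγ1, LipschitzWith.of_dist_le_mul fun Q Q' => ?_⟩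
  change _ ≤ γ * dist Q Q'
  have hnonneg : 0 ≤ γ * dist Q Q' := mul_nonneg hγ0 dist_nonneg
  have hle (R R' : S → A → ℝ) (s : S) (a : A) : R s a ≤ R' s a + dist R R' := by
    have hdist := (dist_le_pi_dist (R s) (R' s) a).trans (dist_le_pi_dist R R' s)
    rw [Real.dist_eq] at hdist
    linarith [le_abs_self (R s a - R' s a)]
  refine (dist_pi_le_iff hnonneg).2 fun s => (dist_pi_le_iff hnonneg).2 fun a => ?_
  have h₁ := bellman_le_add hP r hγ0 hω0 hω1 dist_nonneg (hle Q Q') s a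
  have h₂ := bellman_le_add hP r hγ0 hω0 hω1 dist_nonneg (hle Q' Q) s a
  rw [dist_comm Q' Q] at h₂
  rw [Real.dist_eq, abs_sub_le_iff]
  constructor <;> linarith

/-- The robust Bellman operator has a unique fixed point. -/
theorem robust_bellman_unique_fixed_point
    {S A : Type*} [Fintype S] [Fintype A] [Nonempty S] [Nonempty A]
    (P : S → A → S → ℝ) (hP : IsKernel P)
    (r : S → A → ℝ) (γ ω : ℝ) (hγ0 : 0 < γ) (hγ1 : γ < 1) (hω0 : 0 ≤ ω) (hω1 : ω ≤ 1) :
    ∃! Qstar : S → A → ℝ, bellman P r γ ω Qstar = Qstar := by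
  have hT := contractingWith_bellman hP r hγ0.le hγ1 hω0 hω1
  exact ⟨hT.fixedPoint, hT.fixedPoint_isFixedPt, fun _ hQ => hT.fixedPoint_unique hQ⟩
end
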